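/- arXiv:2210.04732 — 6 statements merged into one kernel-verified Lean document; each statement's English description precedes it below -/
import Mathlib

section
/- Let T ∈ O(n+2,1) with w = T₀₀ > 0, written in block form T = [[w, u],[v, Q]]. Then for every x ∈ ℝ^{n+2} with |x| = 1: u·x + w > 0 and |Qx + v| = u·x + w. In particular Ψ(T)(x) = (Qx + v)/(u·x + w) lies in S^{n+1}, so Ψ(T) is a well-defined map of the sphere to itself. -/
open Matrix

/-- The matrix `I₁ = diag(-1,1,…,1)`. -/
def I1 (N : ℕ) : Matrix (Fin N) (Fin N) ℝ :=
  Matrix.diagonal fun i => if (i : ℕ) = 0 then -1 else 1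

/-- The transpose of a Lorentz matrix is again a Lorentz matrix. -/
theorem transpose_mul_I1_mul {N : ℕ} {T : Matrix (Fin N) (Fin N) ℝ}
    (hT : T * I1 N * Tᵀ = I1 N) : Tᵀ * I1 N * T = I1 N := by
  have hI : I1 N * I1 N = 1 := by
    rw [I1, Matrix.diagonal_mul_diagonal, ← Matrix.diagonal_one]
    congr 1
    ext i
    split_ifs <;> norm_num
  have hinv : I1 N * Tᵀ * I1 N * T = 1 := by
    apply mul_eq_one_comm.mp
    rw [← hI]
    nth_rewrite 3 [← hT]
    simp only [Matrix.mul_assoc]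
  calc Tᵀ * I1 N * T = I1 N * I1 N * (Tᵀ * I1 N * T) := by rw [hI, Matrix.one_mul]
    _ = I1 N * (I1 N * Tᵀ * I1 N * T) := by simp only [Matrix.mul_assoc]
    _ = I1 N := by rw [hinv, Matrix.mul_one]

/-- The quadratic form of `I1` in coordinates. -/
theorem dotProduct_I1_mulVec {m : ℕ} (y : Fin (m + 1) → ℝ) :
    y ⬝ᵥ (I1 (m + 1) *ᵥ y) = -y 0 ^ 2 + ∑ i : Fin m, y i.succ ^ 2 := by
  simp [I1, dotProduct, Matrix.mulVec_diagonal, Fin.sum_univ_succ, pow_two]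

/-- A Lorentz matrix preserves the quadratic form of `I1`. -/
theorem lorentz_form_mulVec {m : ℕ} {T : Matrix (Fin (m + 1)) (Fin (m + 1)) ℝ}
    (hT : T * I1 (m + 1) * Tᵀ = I1 (m + 1)) (y : Fin (m + 1) → ℝ) :
    -(T *ᵥ y) 0 ^ 2 + ∑ i : Fin m, (T *ᵥ y) i.succ ^ 2
      = -y 0 ^ 2 + ∑ i : Fin m, y i.succ ^ 2 := by
  rw [← dotProduct_I1_mulVec, ← dotProduct_I1_mulVec]
  nth_rewrite 2 [← transpose_mul_I1_mul hT]
  rw [← Matrix.mulVec_mulVec, ← Matrix.mulVec_mulVec, Matrix.dotProduct_mulVec y Tᵀ,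
    Matrix.vecMul_transpose]

/-- The first row of a Lorentz matrix is timelike. -/
theorem sum_first_row_sq {m : ℕ} {T : Matrix (Fin (m + 1)) (Fin (m + 1)) ℝ}
    (hT : T * I1 (m + 1) * Tᵀ = I1 (m + 1)) :
    ∑ j : Fin m, T 0 j.succ ^ 2 = T 0 0 ^ 2 - 1 := by
  have h := congrFun (congrFun hT 0) 0
  rw [I1, Matrix.mul_apply] at h
  simp only [Matrix.mul_diagonal, Fin.sum_univ_succ, Matrix.transpose_apply,
    Matrix.diagonal_apply_eq] at h
  simp [← pow_two] at h
  linarith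

/-- For `T = [[w,u],[v,Q]] ∈ O(n+2,1)` with `w = T₀₀ > 0` and any unit vector
`x ∈ S^{n+1}`: `u·x + w > 0`, `|Qx + v| = u·x + w` (stated via squares), and hence
`Ψ(T)(x) = (Qx+v)/(u·x+w)` lies on the unit sphere. -/
theorem moebius_map_well_defined (n : ℕ) (T : Matrix (Fin (n + 3)) (Fin (n + 3)) ℝ)
    (hT : T * I1 (n + 3) * Tᵀ = I1 (n + 3)) (hw : 0 < T 0 0)
    (x : Fin (n + 2) → ℝ) (hx : ∑ i, x i ^ 2 = 1) :
    0 < (∑ j, T 0 j.succ * x j) + T 0 0 ∧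
    (∑ i : Fin (n + 2), ((∑ j, T i.succ j.succ * x j) + T i.succ 0) ^ 2
      = ((∑ j, T 0 j.succ * x j) + T 0 0) ^ 2) ∧
    ∑ i : Fin (n + 2),
      (((∑ j, T i.succ j.succ * x j) + T i.succ 0)
        / ((∑ j, T 0 j.succ * x j) + T 0 0)) ^ 2 = 1 := by
  have hrow := sum_first_row_sq hT
  have hcs := Finset.sum_mul_sq_le_sq_mul_sq Finset.univ (fun j : Fin (n + 2) => T 0 j.succ) x
  rw [hx, hrow] at hcs
  have hpos : 0 < (∑ j, T 0 j.succ * x j) + T 0 0 := by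
    nlinarith
  have hsq : ∑ i : Fin (n + 2), ((∑ j, T i.succ j.succ * x j) + T i.succ 0) ^ 2
      = ((∑ j, T 0 j.succ * x j) + T 0 0) ^ 2 := by
    have happ : ∀ i, (T *ᵥ (Fin.cons 1 x : Fin (n + 3) → ℝ)) i
        = (∑ j, T i j.succ * x j) + T i 0 := by
      intro i
      simp [Matrix.mulVec, dotProduct, Fin.sum_univ_succ (n := n + 2), add_comm (T i 0)]
    have h := lorentz_form_mulVec hT (Fin.cons 1 x)
    simp only [happ, Fin.cons_zero, Fin.cons_succ, hx] at h
    linarith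
  refine ⟨hpos, hsq, ?_⟩
  simp only [div_pow]
  rw [← Finset.sum_div, hsq, div_self (pow_pos hpos 2).ne']
end

section
/- For all T, S ∈ O⁺(n+2,1) and all x ∈ S^{n+1}, one has Ψ(T·S)(x) = Ψ(T)(Ψ(S)(x)); i.e., Ψ : O⁺(n+2,1) → maps of S^{n+1} is a group action (the homomorphism onto the Möbius transformation group). -/
open Matrix

/-- For `T = [[w,u],[v,Q]]`, the Möbius transformation
`Ψ(T)(x) = (Qx + v)/(u·x + w)` of the sphere `S^{n+1}`. -/
noncomputable def Psi (n : ℕ) (T : Matrix (Fin (n + 3)) (Fin (n + 3)) ℝ)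
    (x : Fin (n + 2) → ℝ) : Fin (n + 2) → ℝ :=
  fun i => ((∑ j, T i.succ j.succ * x j) + T i.succ 0)
    / ((∑ j, T 0 j.succ * x j) + T 0 0)

/-- On the unit sphere the denominator of `Ψ(S)` is positive. -/
theorem Psi_denom_pos (n : ℕ) (S : Matrix (Fin (n + 3)) (Fin (n + 3)) ℝ)
    (hS : S * I1 (n + 3) * Sᵀ = I1 (n + 3)) (hS0 : 0 < S 0 0)
    (x : Fin (n + 2) → ℝ) (hx : ∑ i, x i ^ 2 = 1) :
    0 < (∑ j, S 0 j.succ * x j) + S 0 0 := by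
  have h := congrFun (congrFun hS 0) 0
  simp only [I1, Matrix.mul_apply (M := S * _), Matrix.mul_diagonal, Matrix.transpose_apply,
    Matrix.diagonal_apply_eq] at h
  rw [Fin.sum_univ_succ] at h
  simp only [Fin.val_zero, Fin.val_succ, Nat.succ_ne_zero, if_true, if_false, mul_one] at h
  have hcs := Finset.sum_mul_sq_le_sq_mul_sq Finset.univ (fun j : Fin (n + 2) => S 0 j.succ) x
  simp only [← pow_two] at h
  rw [hx, mul_one] at hcs
  have hlt : |∑ j, S 0 j.succ * x j| < S 0 0 := abs_lt_of_sq_lt_sq (by linarith) hS0.le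
  linarith [(abs_lt.mp hlt).1]

/-- Applying a row of `T * S` to `(1, x)` scales the same row of `T` applied to `(1, Ψ(S)(x))`
by the denominator of `Ψ(S)`. -/
theorem mul_row_eq_denom_mul (n : ℕ) (T S : Matrix (Fin (n + 3)) (Fin (n + 3)) ℝ)
    (x : Fin (n + 2) → ℝ) (hd : (∑ j, S 0 j.succ * x j) + S 0 0 ≠ 0) (a : Fin (n + 3)) :
    (∑ j, (T * S) a j.succ * x j) + (T * S) a 0 =
      ((∑ j, S 0 j.succ * x j) + S 0 0) * ((∑ k, T a k.succ * Psi n S x k) + T a 0) := by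
  have hrow (k : Fin (n + 2)) :
      ((∑ j, S 0 j.succ * x j) + S 0 0) * (T a k.succ * Psi n S x k) =
        T a k.succ * ((∑ j, S k.succ j.succ * x j) + S k.succ 0) := by
    rw [mul_left_comm, Psi, mul_div_cancel₀ _ hd]
  rw [mul_add, Finset.mul_sum, Finset.sum_congr rfl fun k _ => hrow k]
  have hsum : ∑ j, (T * S) a j.succ * x j = ∑ k, T a k * ∑ j, S k j.succ * x j := by
    simp only [Matrix.mul_apply, Finset.sum_mul, Finset.mul_sum, mul_assoc]
    exact Finset.sum_comm
  rw [hsum, Matrix.mul_apply, Fin.sum_univ_succ, Fin.sum_univ_succ (fun k => T a k * S k 0)]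
  simp only [mul_add, Finset.sum_add_distrib]
  ring

/-- `Ψ` is a homomorphism: for `T, S ∈ O⁺(n+2,1)` and `x ∈ S^{n+1}`,
`Ψ(T·S)(x) = Ψ(T)(Ψ(S)(x))`. -/
theorem Psi_mul (n : ℕ) (T S : Matrix (Fin (n + 3)) (Fin (n + 3)) ℝ)
    (hT : T * I1 (n + 3) * Tᵀ = I1 (n + 3)) (hT0 : 0 < T 0 0)
    (hS : S * I1 (n + 3) * Sᵀ = I1 (n + 3)) (hS0 : 0 < S 0 0)
    (x : Fin (n + 2) → ℝ) (hx : ∑ i, x i ^ 2 = 1) :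
    Psi n (T * S) x = Psi n T (Psi n S x) := by
  have hd := (Psi_denom_pos n S hS hS0 x hx).ne'
  funext i
  rw [Psi, mul_row_eq_denom_mul n T S x hd, mul_row_eq_denom_mul n T S x hd,
    mul_div_mul_left _ _ hd, ← Psi]
end

section
/- If T ∈ O⁺(n+2,1) satisfies Ψ(T)(x) = x for every x ∈ S^{n+1}, then T is the identity matrix. (The homomorphism Ψ from O⁺(n+2,1) to the Möbius transformation group of S^{n+1} is injective.) -/
open Matrix

/-- The fixed point equation for `Ψ(T)` on the sphere, with the denominator cleared. -/
theorem Psi_fixed_apply {n : ℕ} {T : Matrix (Fin (n + 3)) (Fin (n + 3)) ℝ}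
    {x : Fin (n + 2) → ℝ} (hx : ∑ i, x i ^ 2 = 1) (h : Psi n T x = x) (i : Fin (n + 2)) :
    (∑ j, T i.succ j.succ * x j) + T i.succ 0 =
      x i * ((∑ j, T 0 j.succ * x j) + T 0 0) := by
  have hd : (∑ j, T 0 j.succ * x j) + T 0 0 ≠ 0 := by
    intro hd
    have hx0 : x = 0 := by
      rw [← h]
      funext k
      simp [Psi, hd]
    simp [hx0] at hx
  have hi := congrFun h i
  rwa [Psi, div_eq_iff hd] at hi

/-- If `Ψ(T)` is the identity on the sphere, then `T` is a scalar matrix. -/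
theorem eq_smul_one_of_Psi_fixed {n : ℕ} {T : Matrix (Fin (n + 3)) (Fin (n + 3)) ℝ}
    (hfix : ∀ x : Fin (n + 2) → ℝ, (∑ i, x i ^ 2 = 1) → Psi n T x = x) :
    T = T 0 0 • (1 : Matrix (Fin (n + 3)) (Fin (n + 3)) ℝ) := by
  have hsingle (s : ℝ) (hs : s ^ 2 = 1) (i k : Fin (n + 2)) :
      T i.succ k.succ * s + T i.succ 0 =
        (if i = k then s else 0) * (T 0 k.succ * s + T 0 0) := by
    have hx : ∑ j, (Pi.single k s : Fin (n + 2) → ℝ) j ^ 2 = 1 := by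
      simp [Pi.single_apply, ite_pow, hs]
    simpa [Pi.single_apply] using Psi_fixed_apply hx (hfix _ hx) i
  have hpos := hsingle 1 (by norm_num)
  have hneg := hsingle (-1) (by norm_num)
  have hv (i : Fin (n + 2)) : T i.succ 0 = 0 := by
    obtain ⟨k, hk⟩ := exists_ne i
    have h1 := hpos i k
    have h2 := hneg i k
    simp only [hk.symm, if_false] at h1 h2
    linarith
  have hu (i : Fin (n + 2)) : T 0 i.succ = 0 := by
    have h1 := hpos i i
    have h2 := hneg i i
    simp only [if_true, hv] at h1 h2
    linarith
  ext a b
  refine Fin.cases ?_ (fun i => ?_) a <;> refine Fin.cases ?_ (fun k => ?_) b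
  · simp
  · simp [hu, (Fin.succ_ne_zero k).symm]
  · simp [hv]
  · simpa [hu, hv, Matrix.one_apply] using hpos i k

/-- If `T ∈ O⁺(n+2,1)` induces the identity Möbius transformation of `S^{n+1}`,
then `T` is the identity matrix: `Ψ` is injective. -/
theorem Psi_injective (n : ℕ) (T : Matrix (Fin (n + 3)) (Fin (n + 3)) ℝ)
    (hT : T * I1 (n + 3) * Tᵀ = I1 (n + 3)) (hT0 : 0 < T 0 0)
    (hfix : ∀ x : Fin (n + 2) → ℝ, (∑ i, x i ^ 2 = 1) → Psi n T x = x) :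
    T = 1 := by
  have hs := eq_smul_one_of_Psi_fixed hfix
  have hw : T 0 0 = 1 := by
    rw [hs] at hT
    have h := congrFun (congrFun hT 0) 0
    simp [I1] at h
    nlinarith
  rw [hs, hw, one_smul]
end

section
/- Fix n ≥ 2 and c > 0. For every s ∈ ℝ and y ∈ ℝ^{n-1}, the matrix T_c(s,y) belongs to O⁺(n+2,1); that is, T_c(s,y)·I₁·T_c(s,y)ᵗ = I₁ and the (0,0)-entry (1+|y|²+e^{2cs})/(2e^{cs}) is positive. -/
open Matrix Real

/-- The logarithmic-spiral-cylinder group element `T_c(s,y)`.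
Here `n = m + 2` (so `n ≥ 2`), the matrix has size `n+3 = m+5`, and
`y = (y₁,…,y_{n-1}) ∈ ℝ^{n-1}` is encoded as `y : Fin (m+1) → ℝ` with `y_k = y ⟨k-1⟩`;
the matrix index `3+k` (for `1 ≤ k ≤ n-1`) corresponds to `i.val = k + 3 ∈ {4,…,n+2}`. -/
noncomputable def Tc (m : ℕ) (c s : ℝ) (y : Fin (m + 1) → ℝ) :
    Matrix (Fin (m + 5)) (Fin (m + 5)) ℝ :=
  Matrix.of fun i j =>
    if i.val = 0 then
      if j.val = 0 then (1 + (∑ k, y k ^ 2) + exp (2 * c * s)) / (2 * exp (c * s))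
      else if j.val = 1 then (1 + (∑ k, y k ^ 2) - exp (2 * c * s)) / (2 * exp (c * s))
      else if h : 4 ≤ j.val then y ⟨j.val - 4, by have := j.isLt; omega⟩ else 0
    else if i.val = 1 then
      if j.val = 0 then (1 - (∑ k, y k ^ 2) - exp (2 * c * s)) / (2 * exp (c * s))
      else if j.val = 1 then (1 - (∑ k, y k ^ 2) + exp (2 * c * s)) / (2 * exp (c * s))
      else if h : 4 ≤ j.val then -y ⟨j.val - 4, by have := j.isLt; omega⟩ else 0
    else if i.val = 2 then
      if j.val = 2 then cos s else if j.val = 3 then -sin s else 0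
    else if i.val = 3 then
      if j.val = 2 then sin s else if j.val = 3 then cos s else 0
    else
      if h : 4 ≤ i.val then
        if j.val = 0 ∨ j.val = 1 then y ⟨i.val - 4, by have := i.isLt; omega⟩ * exp (-(c * s))
        else if j.val = i.val then 1 else 0
      else 0

/-- Every index in `Fin (m + 5)` is one of `0, 1, 2, 3` or a fourfold successor. -/
lemma Fin.cases_four_succ {m : ℕ} {P : Fin (m + 5) → Prop}
    (h0 : P 0) (h1 : P (Fin.succ 0)) (h2 : P (Fin.succ (Fin.succ 0)))
    (h3 : P (Fin.succ (Fin.succ (Fin.succ 0))))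
    (h : ∀ k : Fin (m + 1), P k.succ.succ.succ.succ) (i : Fin (m + 5)) : P i :=
  Fin.cases h0 (Fin.cases h1 (Fin.cases h2 (Fin.cases h3 h))) i

/-- The entries of `T * I₁ * Tᵀ`, with the sum split along the first four coordinates. -/
lemma mul_I1_mul_transpose_apply {m : ℕ} (T : Matrix (Fin (m + 5)) (Fin (m + 5)) ℝ)
    (i j : Fin (m + 5)) :
    (T * I1 (m + 5) * Tᵀ) i j =
      -(T i 0 * T j 0) + (T i (Fin.succ 0) * T j (Fin.succ 0) +
        (T i (Fin.succ (Fin.succ 0)) * T j (Fin.succ (Fin.succ 0)) +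
        (T i (Fin.succ (Fin.succ (Fin.succ 0))) * T j (Fin.succ (Fin.succ (Fin.succ 0))) +
        ∑ k : Fin (m + 1), T i k.succ.succ.succ.succ * T j k.succ.succ.succ.succ))) := by
  rw [Matrix.mul_apply]
  simp only [I1, Matrix.mul_diagonal, Matrix.transpose_apply]
  rw [Fin.sum_univ_succ, Fin.sum_univ_succ, Fin.sum_univ_succ, Fin.sum_univ_succ]
  simp only [Fin.val_succ, Fin.val_zero, Nat.add_eq_zero_iff, one_ne_zero, and_false, if_false,
    if_true, mul_one]
  ring

/-- For every `s ∈ ℝ` and `y ∈ ℝ^{n-1}`, the matrix `T_c(s,y)` belongs to `O⁺(n+2,1)`: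
`T·I₁·Tᵀ = I₁` and the `(0,0)` entry is positive. -/
theorem Tc_mem_orthochronous (m : ℕ) (c : ℝ) (hc : 0 < c) (s : ℝ) (y : Fin (m + 1) → ℝ) :
    Tc m c s y * I1 (m + 5) * (Tc m c s y)ᵀ = I1 (m + 5) ∧ 0 < Tc m c s y 0 0 := by
  have hE : exp (c * s) ≠ 0 := (exp_pos _).ne'
  have h2 : exp (2 * c * s) = exp (c * s) ^ 2 := by
    rw [← exp_nat_mul]; congr 1; push_cast; ring
  constructor
  · ext i j
    rw [mul_I1_mul_transpose_apply]
    induction i using Fin.cases_four_succ <;> induction j using Fin.cases_four_succ <;>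
      simp only [Tc, I1, Matrix.of_apply, Matrix.diagonal_apply, Fin.ext_iff, Fin.val_succ,
        Fin.val_zero, h2, exp_neg] <;>
      simp [← pow_two, Fin.val_inj]
    case h.h => simp only [eq_comm]
    all_goals first | ring1 | (field_simp; ring1)
  · have : 0 ≤ ∑ k, y k ^ 2 := Finset.sum_nonneg fun k _ => sq_nonneg (y k)
    simp only [Tc, Matrix.of_apply, Fin.val_zero, if_true]
    positivity
end

section
/- Fix n ≥ 2 and c > 0. For all s, s' ∈ ℝ and y, y' ∈ ℝ^{n-1}, one has the matrix identity T_c(s,y)·T_c(s',y') = T_c(s+s', y + e^{cs}y'). In particular T_c(0,0) is the identity matrix, T_c(s,y)⁻¹ = T_c(-s, -e^{-cs}y), and the set G_e = {T_c(s,y) : s ∈ ℝ, y ∈ ℝ^{n-1}} is a subgroup of O⁺(n+2,1). -/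
open Matrix Real

/-- The logarithmic-spiral group `G_e = {T_c(s,y)}`. -/
def Ge (m : ℕ) (c : ℝ) : Set (Matrix (Fin (m + 5)) (Fin (m + 5)) ℝ) :=
  {T | ∃ (s : ℝ) (y : Fin (m + 1) → ℝ), T = Tc m c s y}

theorem exp_two_mul_mul (c s : ℝ) : exp (2 * c * s) = exp (c * s) ^ 2 := by
  rw [← exp_nat_mul]; push_cast; ring_nf

theorem sum_add_mul_sq {ι : Type*} [Fintype ι] (a : ℝ) (y z : ι → ℝ) :
    ∑ k, (y k + a * z k) ^ 2 =
      ∑ k, y k ^ 2 + 2 * a * ∑ k, y k * z k + a ^ 2 * ∑ k, z k ^ 2 := by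
  simp only [Finset.mul_sum, ← Finset.sum_add_distrib]
  exact Finset.sum_congr rfl fun k _ => by ring

theorem Tc_mul (m : ℕ) (c s s' : ℝ) (y y' : Fin (m + 1) → ℝ) :
    Tc m c s y * Tc m c s' y' = Tc m c (s + s') (fun k => y k + exp (c * s) * y' k) := by
  have hE := (exp_pos (c * s)).ne'
  have hE' := (exp_pos (c * s')).ne'
  have hrow : ∑ x, y x * (y' x * (exp (c * s'))⁻¹) = (∑ x, y x * y' x) * (exp (c * s'))⁻¹ := by
    simp only [Finset.sum_mul, mul_assoc]
  ext i j
  revert j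
  revert i
  simp only [Fin.forall_fin_succ (n := m + 4), Fin.forall_fin_succ (n := m + 3),
    Fin.forall_fin_succ (n := m + 2), Fin.forall_fin_succ (n := m + 1), Matrix.mul_apply,
    Fin.sum_univ_succ (n := m + 4), Fin.sum_univ_succ (n := m + 3),
    Fin.sum_univ_succ (n := m + 2), Fin.sum_univ_succ (n := m + 1)]
  simp [-Fin.succ_zero_eq_one, -Fin.succ_zero_eq_one', -Fin.succ_one_eq_two,
    -Fin.succ_one_eq_two', Tc, exp_two_mul_mul, sum_add_mul_sq, mul_add, exp_add, exp_neg,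
    cos_add, sin_add,
    ← Fin.ext_iff, (Fin.succ_ne_zero _).symm, hrow]
  refine ⟨⟨?_, ?_, fun i => ?_⟩, ⟨?_, ?_, fun i => ?_⟩, ?_, ?_, fun i => ⟨?_, ?_⟩⟩ <;>
    first | ring1 | (field_simp; ring1)

theorem Tc_zero (m : ℕ) (c : ℝ) : Tc m c 0 (fun _ => 0) = 1 := by
  ext i j
  revert j
  revert i
  simp only [Fin.forall_fin_succ (n := m + 4), Fin.forall_fin_succ (n := m + 3),
    Fin.forall_fin_succ (n := m + 2), Fin.forall_fin_succ (n := m + 1)]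
  simp [-Fin.succ_zero_eq_one, -Fin.succ_zero_eq_one', -Fin.succ_one_eq_two,
    -Fin.succ_one_eq_two', Tc, Matrix.one_apply, Fin.val_inj, eq_comm]

theorem Tc_mul_I1_mul_transpose (m : ℕ) (c s : ℝ) (y : Fin (m + 1) → ℝ) :
    Tc m c s y * I1 (m + 5) * (Tc m c s y)ᵀ = I1 (m + 5) := by
  have hE := (exp_pos (c * s)).ne'
  ext i j
  revert j
  revert i
  simp only [I1, Matrix.mul_apply (M := _ * _), Matrix.mul_diagonal, Matrix.transpose_apply,
    Fin.forall_fin_succ (n := m + 4), Fin.forall_fin_succ (n := m + 3),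
    Fin.forall_fin_succ (n := m + 2), Fin.forall_fin_succ (n := m + 1),
    Fin.sum_univ_succ (n := m + 4), Fin.sum_univ_succ (n := m + 3),
    Fin.sum_univ_succ (n := m + 2), Fin.sum_univ_succ (n := m + 1)]
  simp [-Fin.succ_zero_eq_one, -Fin.succ_zero_eq_one', -Fin.succ_one_eq_two,
    -Fin.succ_one_eq_two', Tc, exp_two_mul_mul, exp_neg, Matrix.diagonal_apply,
    ← Fin.ext_iff, (Fin.succ_ne_zero _).symm, ← sq]
  refine ⟨⟨?_, ?_, fun i => ?_⟩, ⟨?_, ?_, fun i => ?_⟩, ?_, ?_, fun i => ⟨?_, ?_, ?_⟩⟩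
  on_goal 11 => simp [eq_comm]
  all_goals first | ring1 | (field_simp; ring1)

theorem Tc_zero_zero_pos (m : ℕ) (c s : ℝ) (y : Fin (m + 1) → ℝ) : 0 < Tc m c s y 0 0 := by
  have : 0 ≤ ∑ k, y k ^ 2 := Finset.sum_nonneg fun k _ => sq_nonneg _
  simp only [Tc, Matrix.of_apply, Fin.val_zero, if_true]
  positivity

theorem Tc_mul_inv (m : ℕ) (c s : ℝ) (y : Fin (m + 1) → ℝ) :
    Tc m c s y * Tc m c (-s) (fun k => -(exp (-(c * s)) * y k)) = 1 := by
  rw [Tc_mul, ← Tc_zero m c, add_neg_cancel]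
  congr 1
  funext k
  rw [mul_neg, ← mul_assoc, ← exp_add, add_neg_cancel, exp_zero, one_mul, add_neg_cancel]

theorem Tc_inv_mul (m : ℕ) (c s : ℝ) (y : Fin (m + 1) → ℝ) :
    Tc m c (-s) (fun k => -(exp (-(c * s)) * y k)) * Tc m c s y = 1 :=
  mul_eq_one_comm.mp (Tc_mul_inv m c s y)

/-- Composition law `T_c(s,y)·T_c(s',y') = T_c(s+s', y + e^{cs}y')`; in particular
`T_c(0,0) = 1`, `T_c(s,y)⁻¹ = T_c(-s, -e^{-cs}y)`, and `G_e` is a subgroup of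
`O⁺(n+2,1)`. -/
theorem Tc_comp (m : ℕ) (c : ℝ) (hc : 0 < c) (s s' : ℝ) (y y' : Fin (m + 1) → ℝ) :
    Tc m c s y * Tc m c s' y' = Tc m c (s + s') (fun k => y k + exp (c * s) * y' k) ∧
    Tc m c 0 (fun _ => 0) = 1 ∧
    Tc m c s y * Tc m c (-s) (fun k => -(exp (-(c * s)) * y k)) = 1 ∧
    Tc m c (-s) (fun k => -(exp (-(c * s)) * y k)) * Tc m c s y = 1 ∧
    (1 : Matrix (Fin (m + 5)) (Fin (m + 5)) ℝ) ∈ Ge m c ∧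
    (∀ A ∈ Ge m c, ∀ B ∈ Ge m c, A * B ∈ Ge m c) ∧
    (∀ A ∈ Ge m c, ∃ B ∈ Ge m c, A * B = 1 ∧ B * A = 1) ∧
    Ge m c ⊆ {T | T * I1 (m + 5) * Tᵀ = I1 (m + 5) ∧ 0 < T 0 0} := by
  refine ⟨Tc_mul m c s s' y y', Tc_zero m c, Tc_mul_inv m c s y, Tc_inv_mul m c s y,
    ⟨0, fun _ => 0, (Tc_zero m c).symm⟩, ?_, ?_, ?_⟩
  · rintro _ ⟨s, y, rfl⟩ _ ⟨s', y', rfl⟩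
    exact ⟨_, _, Tc_mul m c s s' y y'⟩
  · rintro _ ⟨s, y, rfl⟩
    exact ⟨_, ⟨_, _, rfl⟩, Tc_mul_inv m c s y, Tc_inv_mul m c s y⟩
  · rintro _ ⟨s, y, rfl⟩
    exact ⟨Tc_mul_I1_mul_transpose m c s y, Tc_zero_zero_pos m c s y⟩
end

section
/- Fix 1 ≤ m ≤ n-1 and let p ∈ ℝ^{n+3} be the vector with p₀ = 1, p_{m+2} = 1 and all other coordinates 0 (a point of the positive light cone). Then for every u ∈ ℝ^m and orthogonal O, M(u,O)·p = (1+|u|²/2, |u|²/2, u₁,…,u_m, O·ε₁), where ε₁ is the first standard basis vector of ℝ^{n-m+1} and O·ε₁ occupies coordinates m+2,…,n+2. Consequently the G_r-orbit of p equals {(1+|u|²/2, |u|²/2, u, v) : u ∈ ℝ^m, v ∈ ℝ^{n-m+1}, |v| = 1}, a homogeneous submanifold of the positive light cone (the Möbius position image of the cylinder ℝ^m × S^{n-m}). -/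
open Matrix

/-- The cylinder-group element `M(u,O)`.  Here `m = a + 1` and `n = a + b + 2`
(so that `1 ≤ m ≤ n - 1`), the matrix has size `n + 3 = a + b + 5`,
`u ∈ ℝ^m` is encoded as `u : Fin (a+1) → ℝ` (entry `u_k = u ⟨k-1⟩` occupies
index `1 + k ∈ {2,…,m+1}`), and `O` is an `(n-m+1)×(n-m+1) = (b+2)×(b+2)` matrix
occupying indices `m+2,…,n+2`, i.e. `a+3,…,a+b+4`. -/
noncomputable def Mblock (a b : ℕ) (u : Fin (a + 1) → ℝ)
    (O : Matrix (Fin (b + 2)) (Fin (b + 2)) ℝ) :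
    Matrix (Fin (a + b + 5)) (Fin (a + b + 5)) ℝ :=
  Matrix.of fun i j =>
    if i.val = 0 then
      if j.val = 0 then 1 + (∑ k, u k ^ 2) / 2
      else if j.val = 1 then -(∑ k, u k ^ 2) / 2
      else if h : j.val < a + 3 then u ⟨j.val - 2, by omega⟩ else 0
    else if i.val = 1 then
      if j.val = 0 then (∑ k, u k ^ 2) / 2
      else if j.val = 1 then 1 - (∑ k, u k ^ 2) / 2
      else if h : j.val < a + 3 then u ⟨j.val - 2, by omega⟩ else 0
    else if hi : i.val < a + 3 then
      if j.val = 0 then u ⟨i.val - 2, by omega⟩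
      else if j.val = 1 then -u ⟨i.val - 2, by omega⟩
      else if j.val = i.val then 1 else 0
    else
      if hj : a + 3 ≤ j.val then
        O ⟨i.val - (a + 3), by have := i.isLt; omega⟩
          ⟨j.val - (a + 3), by have := j.isLt; omega⟩
      else 0

theorem exists_mul_transpose_eq_one_mulVec_eq {ι : Type*} [Fintype ι] [DecidableEq ι]
    (e v : ι → ℝ) (h : e ⬝ᵥ e = v ⬝ᵥ v) :
    ∃ O : Matrix ι ι ℝ, O * Oᵀ = 1 ∧ O *ᵥ e = v := by
  set w := v - e with hw
  set c : ℝ := 2 / (w ⬝ᵥ w) with hc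
  have hcw : c * c * (w ⬝ᵥ w) = 2 * c := by
    by_cases h0 : w ⬝ᵥ w = 0
    · simp [hc, h0]
    · rw [hc]; field_simp
  refine ⟨1 - c • vecMulVec w w, ?_, ?_⟩
  · have hsq : vecMulVec w w * vecMulVec w w = (w ⬝ᵥ w) • vecMulVec w w := by
      rw [vecMulVec_mul_vecMulVec, vecMulVec_smul]
    simp only [transpose_sub, transpose_one, transpose_smul, transpose_vecMulVec, sub_mul, mul_sub,
      one_mul, mul_one, smul_mul_assoc, mul_smul_comm, hsq, smul_smul]
    rw [smul_sub, smul_smul, ← mul_assoc, hcw, two_mul, add_smul]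
    abel
  · rw [sub_mulVec, one_mulVec, smul_mulVec, vecMulVec_mulVec]
    by_cases h0 : w ⬝ᵥ w = 0
    · have hz : w = 0 := dotProduct_self_eq_zero.mp h0
      have hve : v = e := sub_eq_zero.mp hz
      simp [hz, hve]
    · have hwe : w ⬝ᵥ w = -2 * (w ⬝ᵥ e) := by
        simp only [hw, sub_dotProduct, dotProduct_sub, h, dotProduct_comm e v]
        ring
      have hone : c * (w ⬝ᵥ e) = -1 := by
        rw [hc]; field_simp; linarith
      rw [op_smul_eq_smul, smul_smul, hone, hw]
      simp

/-- With `p` the light-cone point having `p₀ = 1`, `p_{m+2} = 1` and all other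
coordinates `0`, one has `M(u,O)·p = (1+|u|²/2, |u|²/2, u, O·ε₁)`; consequently the
`G_r`-orbit of `p` is `{(1+|u|²/2, |u|²/2, u, v) : u ∈ ℝ^m, |v| = 1}`, the Möbius
position image of the cylinder `ℝ^m × S^{n-m}`, a homogeneous submanifold of the
positive light cone. -/
theorem Mblock_orbit (a b : ℕ) :
    (∀ (u : Fin (a + 1) → ℝ) (O : Matrix (Fin (b + 2)) (Fin (b + 2)) ℝ), O * Oᵀ = 1 →
      (Mblock a b u O).mulVec
          (fun i => if i.val = 0 ∨ i.val = a + 3 then 1 else 0)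
        = fun i =>
            if i.val = 0 then 1 + (∑ k, u k ^ 2) / 2
            else if i.val = 1 then (∑ k, u k ^ 2) / 2
            else if h : i.val < a + 3 then u ⟨i.val - 2, by omega⟩
            else O.mulVec (fun j => if j.val = 0 then 1 else 0)
              ⟨i.val - (a + 3), by have := i.isLt; omega⟩) ∧
    {z : Fin (a + b + 5) → ℝ |
        ∃ (u : Fin (a + 1) → ℝ) (O : Matrix (Fin (b + 2)) (Fin (b + 2)) ℝ),
          O * Oᵀ = 1 ∧ z = (Mblock a b u O).mulVec
            (fun i => if i.val = 0 ∨ i.val = a + 3 then 1 else 0)}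
      = {z : Fin (a + b + 5) → ℝ |
          ∃ (u : Fin (a + 1) → ℝ) (v : Fin (b + 2) → ℝ), (∑ j, v j ^ 2 = 1) ∧
            z = fun i =>
              if i.val = 0 then 1 + (∑ k, u k ^ 2) / 2
              else if i.val = 1 then (∑ k, u k ^ 2) / 2
              else if h : i.val < a + 3 then u ⟨i.val - 2, by omega⟩
              else v ⟨i.val - (a + 3), by have := i.isLt; omega⟩} := by
  refine (and_iff_left_of_imp fun hM => ?_).mpr ?_
  · have he : (fun j : Fin (b + 2) => if j.val = 0 then (1 : ℝ) else 0) ⬝ᵥ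
        (fun j => if j.val = 0 then 1 else 0) = 1 := by
      simp [dotProduct]
    ext z
    constructor
    · rintro ⟨u, O, hO, rfl⟩
      refine ⟨u, O *ᵥ (fun j => if j.val = 0 then 1 else 0), ?_,
        hM u O hO⟩
      calc ∑ j, (O *ᵥ (fun j => if j.val = 0 then 1 else 0)) j ^ 2
          = (O *ᵥ (fun j => if j.val = 0 then 1 else 0)) ⬝ᵥ
              (O *ᵥ (fun j => if j.val = 0 then 1 else 0)) := by simp only [dotProduct, sq]
        _ = 1 := by
          rw [dotProduct_mulVec, ← mulVec_transpose, mulVec_mulVec, mul_eq_one_comm.mp hO,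
            one_mulVec, he]
    · rintro ⟨u, v, hv, rfl⟩
      obtain ⟨O, hO, rfl⟩ := exists_mul_transpose_eq_one_mulVec_eq
        (fun j : Fin (b + 2) => if j.val = 0 then (1 : ℝ) else 0) v
        (by rw [he, ← hv]; simp only [dotProduct, sq])
      exact ⟨u, O, hO, (hM u O hO).symm⟩
  · intro u O _
    have hp : (fun i : Fin (a + b + 5) => if i.val = 0 ∨ i.val = a + 3 then (1 : ℝ) else 0)
        = Pi.single ⟨0, by omega⟩ 1 + Pi.single ⟨a + 3, by omega⟩ 1 := by
      ext i
      simp only [Pi.add_apply, Pi.single_apply, Fin.ext_iff]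
      split_ifs <;> first | omega | norm_num
    have he : (fun j : Fin (b + 2) => if j.val = 0 then (1 : ℝ) else 0) = Pi.single 0 1 := by
      ext j
      simp only [Pi.single_apply, Fin.ext_iff, Fin.val_zero]
    rw [hp, he, mulVec_add, mulVec_single_one, mulVec_single_one, mulVec_single_one]
    ext i
    simp only [Pi.add_apply, col_apply, Mblock, of_apply]
    split_ifs <;> first | omega | contradiction | simp
end
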